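/- arXiv:1507.01400 — 2 statements merged into one kernel-verified Lean document; each statement's English description precedes it below -/
import Mathlib

section
/- Let N be a finite set of nodes, E a finite set of arcs, and C a finite nonempty set of loop-free paths, where each path γ ∈ C is a finite set of arcs with an origin o(γ) ∈ N and a terminus d(γ) ∈ N, and assume that for every pair (x,y) ∈ N×N the set C_{x,y} of paths with origin x and terminus y is nonempty. Then a feasible path-flow w : C → ℝ₊ is a Wardrop equilibrium if and only if w minimizes the total congestion cost Σ_{e∈E} G_e(m_{w'}(e)) among all feasible path-flows w'. -/
open Finset

section WardropSetup

variable {N E C : Type*} [Fintype N] [Fintype E] [Fintype C]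
  [DecidableEq N] [DecidableEq E]

/-- A path-flow `w` is feasible for the marginals `fm` (sources) and `fp` (sinks):
it is nonnegative and satisfies the mass conservation conditions at origins and termini. -/
def Feasible (o dst : C → N) (fm fp : N → ℝ) (w : C → ℝ) : Prop :=
  (∀ γ, 0 ≤ w γ) ∧
  (∀ x : N, ∑ γ ∈ univ.filter fun γ => o γ = x, w γ = fm x) ∧
  (∀ y : N, ∑ γ ∈ univ.filter fun γ => dst γ = y, w γ = fp y)

/-- The arc-mass induced by a path-flow: `m_w(e) = Σ_{γ : e ∈ γ} w(γ)`. -/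
def arcMass (arcs : C → Finset E) (w : C → ℝ) (e : E) : ℝ :=
  ∑ γ ∈ univ.filter fun γ => e ∈ arcs γ, w γ

/-- The travel time of a path: `τ_w(γ) = Σ_{e ∈ γ} g_e(m_w(e))`. -/
def travelTime (arcs : C → Finset E) (g : E → ℝ → ℝ) (w : C → ℝ) (γ : C) : ℝ :=
  ∑ e ∈ arcs γ, g e (arcMass arcs w e)

/-- The minimal travel time between `x` and `y`: `T_w(x,y) = min_{γ ∈ C_{x,y}} τ_w(γ)`. -/
noncomputable def minTime (arcs : C → Finset E) (g : E → ℝ → ℝ) (o dst : C → N)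
    (w : C → ℝ) (x y : N) : ℝ :=
  sInf {s : ℝ | ∃ γ : C, o γ = x ∧ dst γ = y ∧ travelTime arcs g w γ = s}

/-- A feasible path-flow `w` is a Wardrop equilibrium if (i) every path actually used is a
time-minimizing path between its endpoints, and (ii) the induced transport plan
`π_w(x,y) = Σ_{γ ∈ C_{x,y}} w(γ)` minimizes `Σ π(x,y) T_w(x,y)` among all transport
plans `π` between the marginals `fm` and `fp`. -/
noncomputable def IsWardrop (arcs : C → Finset E) (o dst : C → N) (g : E → ℝ → ℝ)
    (fm fp : N → ℝ) (w : C → ℝ) : Prop :=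
  Feasible o dst fm fp w ∧
  (∀ γ : C, 0 < w γ →
    travelTime arcs g w γ = minTime arcs g o dst w (o γ) (dst γ)) ∧
  (∀ π : N → N → ℝ, (∀ x y, 0 ≤ π x y) →
    (∀ x : N, ∑ y : N, π x y = fm x) → (∀ y : N, ∑ x : N, π x y = fp y) →
    ∑ x : N, ∑ y : N,
        (∑ γ ∈ univ.filter fun γ => o γ = x ∧ dst γ = y, w γ) * minTime arcs g o dst w x y ≤
      ∑ x : N, ∑ y : N, π x y * minTime arcs g o dst w x y)

end WardropSetup

open intervalIntegral

section WardropLemmas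

variable {N E C : Type*} [Fintype C]

theorem sub_mul_le_integral_of_monotoneOn {f : ℝ → ℝ} (hf : Continuous f)
    (hmono : MonotoneOn f (Set.Ici 0)) {a b : ℝ} (ha : 0 ≤ a) (hb : 0 ≤ b) :
    (b - a) * f a ≤ (∫ t in (0:ℝ)..b, f t) - ∫ t in (0:ℝ)..a, f t := by
  rw [integral_interval_sub_left (hf.intervalIntegrable _ _) (hf.intervalIntegrable _ _)]
  rcases le_total a b with h | h
  · have := integral_mono_on (μ := MeasureTheory.volume) h
      ((continuous_const (y := f a)).intervalIntegrable _ _) (hf.intervalIntegrable _ _)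
      fun t ht => hmono (Set.mem_Ici.2 ha) (Set.mem_Ici.2 (ha.trans ht.1)) ht.1
    simpa using this
  · have := integral_mono_on (μ := MeasureTheory.volume) h (hf.intervalIntegrable _ _)
      ((continuous_const (y := f a)).intervalIntegrable _ _)
      fun t ht => hmono (Set.mem_Ici.2 (hb.trans ht.1)) (Set.mem_Ici.2 ha) ht.2
    rw [integral_symm]
    simp only [integral_const, smul_eq_mul] at this
    linarith

theorem arcMass_nonneg [DecidableEq E]
    (arcs : C → Finset E) {w : C → ℝ} (hw : ∀ γ, 0 ≤ w γ) (e : E) :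
    0 ≤ arcMass arcs w e :=
  sum_nonneg fun γ _ => hw γ

theorem arcMass_add_mul_sub [DecidableEq E]
    (arcs : C → Finset E) (w w' : C → ℝ) (t : ℝ) (e : E) :
    arcMass arcs (fun γ => w γ + t * (w' γ - w γ)) e =
      arcMass arcs w e + t * (arcMass arcs w' e - arcMass arcs w e) := by
  simp only [arcMass, sum_add_distrib, ← mul_sum, sum_sub_distrib]

theorem Feasible.add_mul_sub [DecidableEq N] {o dst : C → N} {fm fp : N → ℝ} {w w' : C → ℝ}
    (hw : Feasible o dst fm fp w) (hw' : Feasible o dst fm fp w') {t : ℝ}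
    (ht0 : 0 ≤ t) (ht1 : t ≤ 1) :
    Feasible o dst fm fp fun γ => w γ + t * (w' γ - w γ) := by
  refine ⟨fun γ => ?_, fun x => ?_, fun y => ?_⟩
  · nlinarith [mul_nonneg ht0 (hw'.1 γ), mul_nonneg (sub_nonneg.2 ht1) (hw.1 γ)]
  · simp only [sum_add_distrib, ← mul_sum, sum_sub_distrib, hw.2.1, hw'.2.1]
    ring
  · simp only [sum_add_distrib, ← mul_sum, sum_sub_distrib, hw.2.2, hw'.2.2]
    ring

theorem sum_mul_travelTime [Fintype E] [DecidableEq E]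
    (arcs : C → Finset E) (g : E → ℝ → ℝ) (w w' : C → ℝ) :
    ∑ γ, w' γ * travelTime arcs g w γ =
      ∑ e, arcMass arcs w' e * g e (arcMass arcs w e) := by
  simp only [travelTime, mul_sum]
  unfold arcMass
  simp only [sum_mul]
  exact sum_comm' (by simp)

theorem minTime_le [DecidableEq E]
    (arcs : C → Finset E) (g : E → ℝ → ℝ) (o dst : C → N) (w : C → ℝ) (γ : C) :
    minTime arcs g o dst w (o γ) (dst γ) ≤ travelTime arcs g w γ := by
  refine csInf_le (Set.Finite.bddBelow ?_) ⟨γ, rfl, rfl, rfl⟩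
  refine (Set.finite_range (travelTime arcs g w)).subset ?_
  rintro _ ⟨γ, -, -, rfl⟩
  exact ⟨γ, rfl⟩

theorem exists_travelTime_eq_minTime [DecidableEq E]
    (arcs : C → Finset E) (g : E → ℝ → ℝ) {o dst : C → N}
    (w : C → ℝ) {x y : N} (h : ∃ γ, o γ = x ∧ dst γ = y) :
    ∃ γ, o γ = x ∧ dst γ = y ∧ travelTime arcs g w γ = minTime arcs g o dst w x y := by
  obtain ⟨γ, hx, hy⟩ := h
  refine Set.Nonempty.csInf_mem (s := {s : ℝ | ∃ γ : C, o γ = x ∧ dst γ = y ∧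
    travelTime arcs g w γ = s}) ⟨_, γ, hx, hy, rfl⟩ ?_
  refine (Set.finite_range (travelTime arcs g w)).subset ?_
  rintro _ ⟨γ, -, -, rfl⟩
  exact ⟨γ, rfl⟩

/-- The transport plan induced by a path-flow. -/
def transportPlan [DecidableEq N] (o dst : C → N) (w : C → ℝ) (x y : N) : ℝ :=
  ∑ γ ∈ univ.filter fun γ => o γ = x ∧ dst γ = y, w γ

theorem sum_transportPlan_mul [Fintype N] [DecidableEq N]
    (o dst : C → N) (w : C → ℝ) (T : N → N → ℝ) :
    ∑ x, ∑ y, transportPlan o dst w x y * T x y = ∑ γ, w γ * T (o γ) (dst γ) := by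
  simp only [transportPlan, sum_mul, sum_filter, ite_and]
  simp only [sum_comm (s := (univ : Finset N)) (t := (univ : Finset C))]
  simp

theorem Feasible.sum_transportPlan_right [Fintype N] [DecidableEq N]
    {o dst : C → N} {fm fp : N → ℝ} {w : C → ℝ}
    (hw : Feasible o dst fm fp w) (x : N) : ∑ y, transportPlan o dst w x y = fm x := by
  rw [← hw.2.1 x, ← sum_fiberwise _ dst]
  simp only [transportPlan, filter_filter]

theorem Feasible.sum_transportPlan_left [Fintype N] [DecidableEq N]
    {o dst : C → N} {fm fp : N → ℝ} {w : C → ℝ}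
    (hw : Feasible o dst fm fp w) (y : N) : ∑ x, transportPlan o dst w x y = fp y := by
  rw [← hw.2.2 y, ← sum_fiberwise _ o]
  simp only [transportPlan, filter_filter, and_comm]

/-- Every transport plan is realised by a feasible path-flow routing the mass from `x` to `y`
along the single path `σ x y`. -/
theorem exists_feasible_of_transportPlan [Fintype N] [DecidableEq N]
    {o dst : C → N} {fm fp : N → ℝ} {π : N → N → ℝ}
    (hπ : ∀ x y, 0 ≤ π x y) (hm : ∀ x, ∑ y, π x y = fm x) (hp : ∀ y, ∑ x, π x y = fp y)
    (σ : N → N → C) (ho : ∀ x y, o (σ x y) = x) (hd : ∀ x y, dst (σ x y) = y) :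
    ∃ w, Feasible o dst fm fp w ∧ ∀ f : C → ℝ, ∑ γ, w γ * f γ = ∑ x, ∑ y, π x y * f (σ x y) := by
  classical
  have key : ∀ f : C → ℝ, ∑ γ, (∑ x, ∑ y, if σ x y = γ then π x y else 0) * f γ =
      ∑ x, ∑ y, π x y * f (σ x y) := fun f => by
    simp only [sum_mul, sum_comm (s := (univ : Finset C)) (t := (univ : Finset N))]
    simp [ite_mul]
  refine ⟨fun γ => ∑ x, ∑ y, if σ x y = γ then π x y else 0, ⟨fun γ => ?_, fun x => ?_,
    fun y => ?_⟩, key⟩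
  · exact sum_nonneg fun x _ => sum_nonneg fun y _ => by split_ifs <;> simp [hπ]
  · have := key fun γ => if o γ = x then 1 else 0
    simp only [ho, mul_ite, mul_one, mul_zero] at this
    rw [sum_filter, this, ← hm x, sum_comm]
    simp
  · have := key fun γ => if dst γ = y then 1 else 0
    simp only [hd, mul_ite, mul_one, mul_zero] at this
    rw [sum_filter, this, ← hp y]
    simp

/-- Wardrop equilibria are characterised by a variational inequality for the frozen travel times. -/
theorem isWardrop_iff_sum_mul_travelTime_le [Fintype N] [DecidableEq N] [Fintype E]
    [DecidableEq E] {arcs : C → Finset E} {o dst : C → N}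
    (hpaths : ∀ x y : N, ∃ γ : C, o γ = x ∧ dst γ = y) {g : E → ℝ → ℝ} {fm fp : N → ℝ}
    {w : C → ℝ} (hw : Feasible o dst fm fp w) :
    IsWardrop arcs o dst g fm fp w ↔ ∀ w', Feasible o dst fm fp w' →
      ∑ γ, w γ * travelTime arcs g w γ ≤ ∑ γ, w' γ * travelTime arcs g w γ := by
  have hle (v : C → ℝ) (hv : ∀ γ, 0 ≤ v γ) (γ : C) :
      v γ * minTime arcs g o dst w (o γ) (dst γ) ≤ v γ * travelTime arcs g w γ :=
    mul_le_mul_of_nonneg_left (minTime_le arcs g o dst w γ) (hv γ)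
  constructor
  · rintro ⟨-, hused, hopt⟩ w' hw'
    calc ∑ γ, w γ * travelTime arcs g w γ
        = ∑ γ, w γ * minTime arcs g o dst w (o γ) (dst γ) := by
          refine sum_congr rfl fun γ _ => ?_
          rcases (hw.1 γ).eq_or_lt with h | h
          · simp [← h]
          · rw [hused γ h]
      _ = ∑ x, ∑ y, transportPlan o dst w x y * minTime arcs g o dst w x y :=
          (sum_transportPlan_mul o dst w _).symm
      _ ≤ ∑ x, ∑ y, transportPlan o dst w' x y * minTime arcs g o dst w x y :=
          hopt _ (fun x y => sum_nonneg fun γ _ => hw'.1 γ) hw'.sum_transportPlan_right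
            hw'.sum_transportPlan_left
      _ = ∑ γ, w' γ * minTime arcs g o dst w (o γ) (dst γ) := sum_transportPlan_mul o dst w' _
      _ ≤ ∑ γ, w' γ * travelTime arcs g w γ := sum_le_sum fun γ _ => hle w' hw'.1 γ
  · intro h
    choose σ ho hd hσ using fun x y => exists_travelTime_eq_minTime arcs g w (hpaths x y)
    have hplan (π : N → N → ℝ) (hπ : ∀ x y, 0 ≤ π x y) (hm : ∀ x, ∑ y, π x y = fm x)
        (hp : ∀ y, ∑ x, π x y = fp y) : ∑ γ, w γ * travelTime arcs g w γ ≤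
          ∑ x, ∑ y, π x y * minTime arcs g o dst w x y := by
      obtain ⟨w', hw', hsum⟩ := exists_feasible_of_transportPlan hπ hm hp σ ho hd
      simpa only [hsum, hσ] using h w' hw'
    refine ⟨hw, fun γ hγ => ?_, fun π hπ hm hp => ?_⟩
    · have hself := hplan (transportPlan o dst w) (fun x y => sum_nonneg fun γ _ => hw.1 γ)
        hw.sum_transportPlan_right hw.sum_transportPlan_left
      rw [sum_transportPlan_mul] at hself
      have heq := (sum_eq_sum_iff_of_le fun γ _ => hle w hw.1 γ).1
        ((sum_le_sum fun γ _ => hle w hw.1 γ).antisymm hself) γ (mem_univ γ)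
      exact (mul_left_cancel₀ hγ.ne' heq).symm
    · refine le_trans ?_ (hplan π hπ hm hp)
      exact (sum_transportPlan_mul o dst w _).trans_le (sum_le_sum fun γ _ => hle w hw.1 γ)

theorem sum_mul_travelTime_le_iff_sum_integral_le [DecidableEq N] [Fintype E]
    [DecidableEq E] {arcs : C → Finset E} {o dst : C → N}
    {g : E → ℝ → ℝ} (hg : ∀ e, Continuous (g e)) (hmono : ∀ e, MonotoneOn (g e) (Set.Ici 0))
    {fm fp : N → ℝ} {w : C → ℝ} (hw : Feasible o dst fm fp w) :
    (∀ w', Feasible o dst fm fp w' →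
      ∑ γ, w γ * travelTime arcs g w γ ≤ ∑ γ, w' γ * travelTime arcs g w γ) ↔
    ∀ w', Feasible o dst fm fp w' → ∑ e, (∫ t in (0:ℝ)..arcMass arcs w e, g e t) ≤
      ∑ e, ∫ t in (0:ℝ)..arcMass arcs w' e, g e t := by
  simp only [sum_mul_travelTime]
  constructor <;> intro h w' hw'
  · have hconv := sum_le_sum fun e (_ : e ∈ univ) => sub_mul_le_integral_of_monotoneOn (hg e)
      (hmono e) (arcMass_nonneg arcs hw.1 e) (arcMass_nonneg arcs hw'.1 e)
    simp only [sub_mul, sum_sub_distrib] at hconv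
    linarith [h w' hw']
  · set m := arcMass arcs w
    set d : E → ℝ := fun e => arcMass arcs w' e - m e with hd
    have hpos : ∀ t ∈ Set.Ioc (0:ℝ) 1, 0 ≤ ∑ e, d e * g e (m e + t * d e) := by
      intro t ht
      have hwt := hw.add_mul_sub hw' ht.1.le ht.2
      have hconv := sum_le_sum fun e (_ : e ∈ univ) => sub_mul_le_integral_of_monotoneOn (hg e)
        (hmono e) (arcMass_nonneg arcs hwt.1 e) (arcMass_nonneg arcs hw.1 e)
      have hmin := h _ hwt
      simp only [arcMass_add_mul_sub, sum_sub_distrib] at hconv hmin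
      have hmul : ∑ e, (m e - (m e + t * d e)) * g e (m e + t * d e) =
          -(t * ∑ e, d e * g e (m e + t * d e)) := by
        rw [mul_sum, ← sum_neg_distrib]
        exact sum_congr rfl fun e _ => by ring
      refine nonneg_of_mul_nonneg_right (a := t) ?_ ht.1
      linarith [hmul.symm.trans_le hconv]
    have hcont : Continuous fun t : ℝ => ∑ e, d e * g e (m e + t * d e) := by fun_prop
    have hlim := (hcont.tendsto 0).mono_left (nhdsWithin_le_nhds (s := Set.Ioi 0))
    have h0 := ge_of_tendsto hlim (Filter.mem_of_superset (Ioc_mem_nhdsGT one_pos) hpos)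
    simpa [hd, sub_mul] using h0

end WardropLemmas

/-- Beckmann–McGuire–Winsten: a feasible path-flow `w` is a Wardrop
equilibrium if and only if it minimizes the total congestion cost
`Σ_{e ∈ E} G_e(m_{w'}(e))`, with `G_e(m) = ∫₀^m g_e`, among all feasible path-flows `w'`. -/
theorem stmt_0 {N E C : Type*} [Fintype N] [Fintype E] [Fintype C] [Nonempty C]
    [DecidableEq N] [DecidableEq E]
    (arcs : C → Finset E) (o dst : C → N)
    (hpaths : ∀ x y : N, ∃ γ : C, o γ = x ∧ dst γ = y)
    (g : E → ℝ → ℝ)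
    (hg_cont : ∀ e, Continuous (g e))
    (hg_pos : ∀ e m, 0 ≤ m → 0 < g e m)
    (hg_incr : ∀ e, StrictMonoOn (g e) (Set.Ici 0))
    (G : E → ℝ → ℝ)
    (hG : ∀ e m, G e m = ∫ α in (0:ℝ)..m, g e α)
    (fm fp : N → ℝ)
    (hfm : ∀ x, 0 ≤ fm x) (hfp : ∀ y, 0 ≤ fp y)
    (hmass : ∑ x : N, fm x = ∑ y : N, fp y)
    (w : C → ℝ) (hw : Feasible o dst fm fp w) :
    IsWardrop arcs o dst g fm fp w ↔
      ∀ w' : C → ℝ, Feasible o dst fm fp w' →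
        ∑ e : E, G e (arcMass arcs w e) ≤ ∑ e : E, G e (arcMass arcs w' e) := by
  simp only [hG]
  exact (isWardrop_iff_sum_mul_travelTime_le hpaths hw).trans
    (sum_mul_travelTime_le_iff_sum_integral_le hg_cont (fun e => (hg_incr e).monotoneOn) hw)
end

section
/- Let d ≥ 1, let v : [0,1] × ℝ^d → ℝ^d be a C¹ vector field, and let X : [0,1] × ℝ^d → ℝ^d satisfy the flow equations ∂_t X(t,x) = v(t, X(t,x)) for all (t,x) ∈ [0,1] × ℝ^d and X(0,x) = x for all x. Let g : [0,1] × ℝ^d → ℝ be a C¹ nonnegative function solving the continuity equation ∂_t g(t,x) + div_x ( g(t,x) v(t,x) ) = 0 on [0,1] × ℝ^d, and suppose there is a compact set K ⊆ ℝ^d such that g(t,·) vanishes outside K for every t ∈ [0,1]. Then for every t ∈ [0,1], the flow X(t,·) pushes the measure g(0,·) dx forward to the measure g(t,·) dx; that is, for every bounded continuous φ : ℝ^d → ℝ one has ∫_{ℝ^d} φ(X(t,x)) g(0,x) dx = ∫_{ℝ^d} φ(y) g(t,y) dy. -/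
open MeasureTheory Set

section Jacobian

variable {E : Type*} [NormedAddCommGroup E] [NormedSpace ℝ E] [FiniteDimensional ℝ E]

theorem contDiff_det_one_add_smul :
    ContDiff ℝ 1 (fun p : ℝ × (E →L[ℝ] E) => (1 + p.1 • p.2).det) := by
  set b := Module.finBasis ℝ E
  have h : (fun p : ℝ × (E →L[ℝ] E) => (1 + p.1 • p.2).det) = fun p =>
      ∑ σ : Equiv.Perm (Fin (Module.finrank ℝ E)), ((Equiv.Perm.sign σ : ℤ) : ℝ) *
        ∏ i, b.coord (σ i) ((1 + p.1 • p.2) (b i)) := by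
    funext p
    rw [ContinuousLinearMap.det, ← LinearMap.det_toMatrix b, Matrix.det_apply']
    simp [LinearMap.toMatrix_apply]
  rw [h]
  refine ContDiff.sum fun σ _ => contDiff_const.mul (contDiff_prod fun i _ => ?_)
  have hc : ContDiff ℝ 1 (fun y => b.coord (σ i) y) :=
    (LinearMap.toContinuousLinearMap (b.coord (σ i))).contDiff
  refine hc.comp ?_
  exact (contDiff_const.add (contDiff_fst.smul contDiff_snd)).clm_apply contDiff_const

theorem hasDerivAt_det_one_add_smul (A : E →L[ℝ] E) :
    HasDerivAt (fun τ : ℝ => (1 + τ • A).det) (LinearMap.trace ℝ E A) 0 := by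
  set b := Module.finBasis ℝ E
  set M := LinearMap.toMatrix b b (A : E →ₗ[ℝ] E) with hM
  have h : (fun τ : ℝ => (1 + τ • A).det) = fun τ => (1 + τ • M).det := by
    funext τ
    rw [ContinuousLinearMap.det, ← LinearMap.det_toMatrix b]
    congr 1
    simp [hM, LinearMap.toMatrix_one]
  rw [h, LinearMap.trace_eq_matrix_trace ℝ b, ← hM,
    funext fun τ : ℝ => Matrix.det_one_add_smul τ M]
  set P := (Matrix.det (1 + (Polynomial.X : Polynomial ℝ) • M.map Polynomial.C)).divX.divX
  have h1 := ((P.hasDerivAt 0).mul ((hasDerivAt_id (0:ℝ)).pow 2))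
  have h2 := ((hasDerivAt_id (0:ℝ)).const_mul M.trace).const_add 1
  exact (h2.add h1).congr_deriv (by simp)

theorem exists_pos_forall_abs_lt_of_eq_zero {P : Type*} [PseudoMetricSpace P] {T : Set (ℝ × P)}
    (hT : IsCompact T) {Q : ℝ × P → ℝ} (hQ : ContinuousOn Q T)
    (hT0 : ∀ τ p, (τ, p) ∈ T → ((0 : ℝ), p) ∈ T) (hQ0 : ∀ p, ((0 : ℝ), p) ∈ T → Q (0, p) = 0)
    {ε : ℝ} (hε : 0 < ε) :
    ∃ δ > 0, ∀ τ p, (τ, p) ∈ T → |τ| < δ → |Q (τ, p)| < ε := by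
  obtain ⟨δ, hδ, h⟩ := Metric.uniformContinuousOn_iff.1
    (hT.uniformContinuousOn_of_continuous hQ) ε hε
  refine ⟨δ, hδ, fun τ p hp hτ => ?_⟩
  have := h _ hp _ (hT0 _ _ hp) (by simp [Prod.dist_eq, hτ])
  simpa [hQ0 p (hT0 _ _ hp), Real.dist_eq] using this

/-- A field `w` on `[0,1] × E` with spatial derivative `A`, vanishing outside the compact set `S`,
and a density `g` with derivative `B`, vanishing outside `S`, which solve the continuity
equation. -/
structure IsCompactTransport (w : ℝ × E → E) (A : ℝ × E → E →L[ℝ] E) (g : ℝ × E → ℝ)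
    (B : ℝ × E → ℝ × E →L[ℝ] ℝ) (S : Set E) : Prop where
  isCompact : IsCompact S
  hasFDerivAt_field : ∀ s ∈ Icc (0:ℝ) 1, ∀ x, HasFDerivAt (fun y => w (s, y)) (A (s, x)) x
  continuousOn_field : ContinuousOn w (Icc (0:ℝ) 1 ×ˢ univ)
  continuousOn_fderiv_field : ContinuousOn A (Icc (0:ℝ) 1 ×ˢ univ)
  field_eq_zero : ∀ s ∈ Icc (0:ℝ) 1, ∀ x ∉ S, w (s, x) = 0
  hasFDerivWithinAt_density : ∀ p ∈ Icc (0:ℝ) 1 ×ˢ (univ : Set E),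
    HasFDerivWithinAt g (B p) (Icc (0:ℝ) 1 ×ˢ univ) p
  continuousOn_fderiv_density : ContinuousOn B (Icc (0:ℝ) 1 ×ˢ univ)
  density_eq_zero : ∀ s ∈ Icc (0:ℝ) 1, ∀ x ∉ S, g (s, x) = 0
  density_nonneg : ∀ s ∈ Icc (0:ℝ) 1, ∀ x, 0 ≤ g (s, x)
  continuity_eq : ∀ s ∈ Icc (0:ℝ) 1, ∀ x,
    B (s, x) (1, w (s, x)) + g (s, x) * LinearMap.trace ℝ E (A (s, x)) = 0

namespace IsCompactTransport

variable {w : ℝ × E → E} {A : ℝ × E → E →L[ℝ] E} {g : ℝ × E → ℝ}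
    {B : ℝ × E → ℝ × E →L[ℝ] ℝ} {S : Set E}

omit [FiniteDimensional ℝ E] in
theorem continuousOn_density (h : IsCompactTransport w A g B S) :
    ContinuousOn g (Icc (0:ℝ) 1 ×ˢ univ) :=
  fun p hp => (h.hasFDerivWithinAt_density p hp).continuousWithinAt

theorem jacobian_estimate (h : IsCompactTransport w A g B S) {ε : ℝ} (hε : 0 < ε) :
    ∃ δ > 0, ∀ s τ, 0 ≤ s → 0 ≤ τ → s + τ ≤ 1 → τ < δ → ∀ x ∈ S,
      |(|(1 + τ • A (s, x)).det| * g (s + τ, x + τ • w (s, x)) - g (s, x))| ≤ ε * τ := by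
  set D : ℝ × (E →L[ℝ] E) → ℝ := fun p => (1 + p.1 • p.2).det with hD
  have hDc : ContDiff ℝ 1 D := contDiff_det_one_add_smul
  set T : Set (ℝ × (ℝ × E)) := {q | 0 ≤ q.1 ∧ 0 ≤ q.2.1 ∧ q.2.1 + q.1 ≤ 1 ∧ q.2.2 ∈ S} with hTdef
  have hT : IsCompact T := by
    refine (isCompact_Icc (a := (0:ℝ)) (b := 1)).prod
      ((isCompact_Icc (a := (0:ℝ)) (b := 1)).prod h.isCompact) |>.of_isClosed_subset ?_ ?_
    · exact (isClosed_le continuous_const continuous_fst).inter <|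
        (isClosed_le continuous_const (continuous_fst.comp continuous_snd)).inter <|
        (isClosed_le (continuous_snd.fst.add continuous_fst) continuous_const).inter <|
        h.isCompact.isClosed.preimage (continuous_snd.comp continuous_snd)
    · rintro ⟨τ, s, x⟩ ⟨h1, h2, h3, h4⟩
      simp only at h1 h2 h3 h4
      exact ⟨⟨h1, by simp only; linarith⟩, ⟨h2, by simp only; linarith⟩, h4⟩
  have hT0 : ∀ τ p, (τ, p) ∈ T → ((0 : ℝ), p) ∈ T := by
    rintro τ ⟨s, x⟩ ⟨h1, h2, h3, h4⟩
    simp only at h1 h2 h3 h4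
    exact ⟨le_rfl, h2, by simp only; linarith, h4⟩
  have hbase : MapsTo (fun q : ℝ × (ℝ × E) => q.2) T (Icc (0:ℝ) 1 ×ˢ univ) := by
    rintro ⟨τ, s, x⟩ ⟨h1, h2, h3, h4⟩
    simp only at h1 h2 h3 h4
    exact ⟨⟨h2, by simp only; linarith⟩, trivial⟩
  have hw : ContinuousOn (fun q : ℝ × (ℝ × E) => w q.2) T :=
    h.continuousOn_field.comp continuousOn_snd hbase
  have hA : ContinuousOn (fun q : ℝ × (ℝ × E) => (q.1, A q.2)) T :=
    continuousOn_fst.prodMk (h.continuousOn_fderiv_field.comp continuousOn_snd hbase)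
  set m : ℝ × (ℝ × E) → ℝ × E := fun q => (q.2.1 + q.1, q.2.2 + q.1 • w q.2) with hm
  have hmc : ContinuousOn m T :=
    ContinuousOn.prodMk (by fun_prop) (continuous_snd.snd.continuousOn.add
      (continuousOn_fst.smul hw))
  have hmT : MapsTo m T (Icc (0:ℝ) 1 ×ˢ univ) := by
    rintro ⟨τ, s, x⟩ ⟨h1, h2, h3, h4⟩
    simp only at h1 h2 h3 h4
    exact ⟨⟨by simp only [hm]; linarith, by simp only [hm]; linarith⟩, trivial⟩
  have hD0 : ∀ a, D (0, a) = 1 := fun a => by simp [hD, ContinuousLinearMap.det]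
  have hD0' : ∀ a, fderiv ℝ D (0, a) (1, 0) = LinearMap.trace ℝ E a := by
    intro a
    have h1 : HasFDerivAt D (fderiv ℝ D (0, a)) (0, a) :=
      (hDc.differentiable one_ne_zero _).hasFDerivAt
    have h2 : HasDerivAt (fun τ : ℝ => (τ, a)) ((1 : ℝ), (0 : E →L[ℝ] E)) 0 :=
      (hasDerivAt_id _).prodMk (hasDerivAt_const _ _)
    have h3 := HasFDerivAt.comp_hasDerivAt (0:ℝ) h1 h2
    exact h3.unique (hasDerivAt_det_one_add_smul a)
  set Q : ℝ × (ℝ × E) → ℝ := fun q => B (m q) (1, w q.2) * D (q.1, A q.2)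
    + g (m q) * fderiv ℝ D (q.1, A q.2) (1, 0) with hQ
  have hQc : ContinuousOn Q T := by
    refine ContinuousOn.add (ContinuousOn.mul ?_ ?_) (ContinuousOn.mul ?_ ?_)
    · exact (h.continuousOn_fderiv_density.comp hmc hmT).clm_apply (continuousOn_const.prodMk hw)
    · exact hDc.continuous.comp_continuousOn hA
    · exact h.continuousOn_density.comp hmc hmT
    · exact ((hDc.continuous_fderiv one_ne_zero).comp_continuousOn hA).clm_apply continuousOn_const
  have hQ0 : ∀ p, ((0 : ℝ), p) ∈ T → Q (0, p) = 0 := by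
    rintro ⟨s, x⟩ hp
    have := h.continuity_eq s (hbase hp).1 x
    simpa [hQ, hm, hD0, hD0'] using this
  obtain ⟨δ₁, hδ₁, H₁⟩ := exists_pos_forall_abs_lt_of_eq_zero hT hQc hT0 hQ0 hε
  obtain ⟨δ₂, hδ₂, H₂⟩ := exists_pos_forall_abs_lt_of_eq_zero (Q := fun q => D (q.1, A q.2) - 1) hT
    ((hDc.continuous.comp_continuousOn hA).sub continuousOn_const) hT0
    (fun p _ => by simp [hD0]) one_pos
  refine ⟨min δ₁ δ₂, lt_min hδ₁ hδ₂, fun s τ hs hτ hsτ hτδ x hx => ?_⟩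
  have hmem : ∀ r ∈ Icc 0 τ, (r, (s, x)) ∈ T := fun r hr =>
    ⟨hr.1, hs, by simp only; linarith [hr.2], hx⟩
  have hpos : 0 < D (τ, A (s, x)) := by
    have := H₂ τ (s, x) (hmem τ ⟨hτ, le_rfl⟩)
      (by rw [abs_of_nonneg hτ]; exact hτδ.trans_le (min_le_right _ _))
    have := (abs_lt.1 this).1
    simp only at this
    linarith
  have hder : ∀ r ∈ Icc 0 τ, HasDerivWithinAt
      (fun r => g (m (r, (s, x))) * D (r, A (s, x))) (Q (r, (s, x))) (Icc 0 τ) r := by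
    intro r hr
    have h1 : HasDerivWithinAt (fun r => m (r, (s, x))) ((1 : ℝ), w (s, x)) (Icc 0 τ) r := by
      have h11 : HasDerivAt (fun r : ℝ => s + r) 1 r := (hasDerivAt_id r).const_add s
      have h12 : HasDerivAt (fun r : ℝ => x + r • w (s, x)) (w (s, x)) r := by
        simpa using ((hasDerivAt_id r).smul_const (w (s, x))).const_add x
      exact (h11.prodMk h12).hasDerivWithinAt
    have h2 := (h.hasFDerivWithinAt_density _ (hmT (hmem r hr))).comp_hasDerivWithinAt r h1
      (fun r' hr' => hmT (hmem r' hr'))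
    have h3 : HasDerivAt (fun τ : ℝ => (τ, A (s, x))) ((1 : ℝ), (0 : E →L[ℝ] E)) r :=
      (hasDerivAt_id _).prodMk (hasDerivAt_const _ _)
    have h4 := ((hDc.differentiable one_ne_zero (r, A (s, x))).hasFDerivAt.comp_hasDerivAt r
      h3).hasDerivWithinAt (s := Icc 0 τ)
    exact h2.mul h4
  have := norm_image_sub_le_of_norm_deriv_le_segment' hder (C := ε) (fun r hr => by
    refine (H₁ r (s, x) (hmem r (Ico_subset_Icc_self hr)) ?_).le
    rw [abs_of_nonneg hr.1]
    exact hr.2.trans (hτδ.trans_le (min_le_left _ _))) τ ⟨hτ, le_rfl⟩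
  have hdet : |(1 + τ • A (s, x)).det| = D (τ, A (s, x)) := abs_of_pos hpos
  rw [hdet, mul_comm]
  simpa [hm, hD0] using this

omit [FiniteDimensional ℝ E] in
theorem exists_lipschitzWith_field (h : IsCompactTransport w A g B S) :
    ∃ C : NNReal, ∀ s ∈ Icc (0:ℝ) 1, LipschitzWith C (fun y => w (s, y)) := by
  obtain ⟨C, hC⟩ := ((isCompact_Icc (a := (0:ℝ)) (b := 1)).prod
    h.isCompact).exists_bound_of_continuousOn
      (h.continuousOn_fderiv_field.mono (prod_mono le_rfl (subset_univ _)))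
  refine ⟨C.toNNReal, fun s hs => ?_⟩
  refine lipschitzWith_of_nnnorm_fderiv_le
    (fun x => (h.hasFDerivAt_field s hs x).differentiableAt) fun x => ?_
  rw [(h.hasFDerivAt_field s hs x).fderiv]
  by_cases hx : x ∈ S
  · rw [← NNReal.coe_le_coe, coe_nnnorm]
    exact (hC (s, x) ⟨hs, hx⟩).trans (Real.le_coe_toNNReal C)
  · have h0 : (fun y => w (s, y)) =ᶠ[nhds x] fun _ => 0 := by
      filter_upwards [h.isCompact.isClosed.isOpen_compl.mem_nhds hx] with y hy
      exact h.field_eq_zero s hs y hy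
    rw [(h.hasFDerivAt_field s hs x).unique ((hasFDerivAt_const 0 x).congr_of_eventuallyEq h0)]
    simp

omit [FiniteDimensional ℝ E] in
theorem euler_estimate (h : IsCompactTransport w A g B S) {ε : ℝ} (hε : 0 < ε) :
    ∃ δ > 0, ∀ s τ, 0 ≤ s → 0 ≤ τ → s + τ ≤ 1 → τ < δ → ∀ γ : ℝ → E,
      (∀ r ∈ Icc (0:ℝ) 1, γ r ∈ S) →
      (∀ r ∈ Icc (0:ℝ) 1, HasDerivWithinAt γ (w (r, γ r)) (Icc 0 1) r) →
      ‖γ (s + τ) - (γ s + τ • w (s, γ s))‖ ≤ ε * τ := by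
  have hc : IsCompact (Icc (0:ℝ) 1 ×ˢ S) := isCompact_Icc.prod h.isCompact
  have hcont : ContinuousOn w (Icc (0:ℝ) 1 ×ˢ S) :=
    h.continuousOn_field.mono (prod_mono le_rfl (subset_univ _))
  obtain ⟨V, hV⟩ := hc.exists_bound_of_continuousOn hcont
  obtain ⟨δ, hδ, H⟩ := Metric.uniformContinuousOn_iff.1
    (hc.uniformContinuousOn_of_continuous hcont) ε hε
  have hM : 0 < |V| + 1 := by positivity
  refine ⟨δ / (|V| + 1), by positivity, fun s τ hs hτ hsτ hτδ γ hγS hγ => ?_⟩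
  rw [lt_div_iff₀ hM] at hτδ
  have hsub : Icc s (s + τ) ⊆ Icc 0 1 := Icc_subset_Icc hs hsτ
  have hs1 : s ∈ Icc (0:ℝ) 1 := hsub ⟨le_rfl, by linarith⟩
  have hγ' : ∀ r ∈ Icc s (s + τ), HasDerivWithinAt γ (w (r, γ r)) (Icc s (s + τ)) r :=
    fun r hr => (hγ r (hsub hr)).mono hsub
  have hdist : ∀ r ∈ Icc s (s + τ), ‖γ r - γ s‖ ≤ |V| * (r - s) :=
    norm_image_sub_le_of_norm_deriv_le_segment' hγ' fun r hr =>
      (hV _ ⟨hsub (Ico_subset_Icc_self hr), hγS r (hsub (Ico_subset_Icc_self hr))⟩).trans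
        (le_abs_self V)
  have hder : ∀ r ∈ Icc s (s + τ), HasDerivWithinAt (fun r => γ r - (r - s) • w (s, γ s))
      (w (r, γ r) - w (s, γ s)) (Icc s (s + τ)) r := by
    intro r hr
    have h1 : HasDerivAt (fun r : ℝ => (r - s) • w (s, γ s)) (w (s, γ s)) r := by
      simpa using ((hasDerivAt_id r).sub_const s).smul_const (w (s, γ s))
    exact (hγ' r hr).sub h1.hasDerivWithinAt
  have := norm_image_sub_le_of_norm_deriv_le_segment' hder (C := ε) (fun r hr => by
    have hr' := Ico_subset_Icc_self hr
    rw [← dist_eq_norm]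
    refine (H (r, γ r) ⟨hsub hr', hγS r (hsub hr')⟩ (s, γ s) ⟨hs1, hγS s hs1⟩ ?_).le
    have hrs : r - s ≤ τ := by linarith [hr.2]
    rw [Prod.dist_eq, max_lt_iff]
    simp only
    rw [Real.dist_eq, abs_of_nonneg (by linarith [hr.1]), dist_eq_norm]
    constructor
    · nlinarith [abs_nonneg V]
    · refine (hdist r hr').trans_lt ?_
      have : |V| * (r - s) ≤ |V| * τ := by gcongr
      nlinarith [abs_nonneg V]) (s + τ) ⟨by linarith, le_rfl⟩
  simpa [sub_sub, add_comm (γ s)] using this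

omit [FiniteDimensional ℝ E] in
theorem lipschitzWith_add_smul {f : E → E} {C : NNReal} (hf : LipschitzWith C f) (τ : NNReal) :
    LipschitzWith (1 + τ * C) (fun x => x + (τ : ℝ) • f x) := by
  refine LipschitzWith.id.add (LipschitzWith.of_dist_le_mul fun x y => ?_)
  rw [dist_eq_norm, ← smul_sub, norm_smul, NNReal.coe_mul, mul_assoc]
  simpa [dist_eq_norm] using
    mul_le_mul_of_nonneg_left (hf.dist_le_mul x y) τ.coe_nonneg

theorem bijective_add_smul {f : E → E} {C : NNReal} (hf : LipschitzWith C f) {τ : NNReal}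
    (hτ : τ * C < 1) : Function.Bijective (fun x => x + (τ : ℝ) • f x) := by
  have happ : ApproximatesLinearOn (fun x => x + (τ : ℝ) • f x)
      ((ContinuousLinearEquiv.refl ℝ E : E ≃L[ℝ] E) : E →L[ℝ] E) univ (τ * C) := by
    rintro x - y -
    have : x + (τ : ℝ) • f x - (y + (τ : ℝ) • f y) -
        ((ContinuousLinearEquiv.refl ℝ E : E ≃L[ℝ] E) : E →L[ℝ] E) (x - y)
        = (τ : ℝ) • (f x - f y) := by
      simp only [ContinuousLinearEquiv.coe_refl, ContinuousLinearMap.coe_id', id_eq, smul_sub]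
      abel
    rw [this, norm_smul, NNReal.coe_mul, mul_assoc]
    simpa [dist_eq_norm] using
      mul_le_mul_of_nonneg_left (hf.dist_le_mul x y) τ.coe_nonneg
  have hc : Subsingleton E ∨ τ * C <
      ‖((ContinuousLinearEquiv.refl ℝ E).symm : E →L[ℝ] E)‖₊⁻¹ := by
    rcases subsingleton_or_nontrivial E with hE | hE
    · exact Or.inl hE
    · refine Or.inr ?_
      have : ‖((ContinuousLinearEquiv.refl ℝ E).symm : E →L[ℝ] E)‖₊ = 1 := by
        simp
      rwa [this, inv_one]
  exact (happ.toHomeomorph _ hc).bijective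

variable [MeasurableSpace E] [BorelSpace E] (μ : Measure E) [μ.IsAddHaarMeasure]

theorem integral_eq_integral_euler (h : IsCompactTransport w A g B S) {C : NNReal} {s : ℝ}
    (hs : s ∈ Icc (0:ℝ) 1) (hC : LipschitzWith C (fun y => w (s, y))) {τ : NNReal}
    (hτ : τ * C < 1) (f : E → ℝ) :
    ∫ y, f y ∂μ = ∫ x, |(1 + (τ : ℝ) • A (s, x)).det| * f (x + (τ : ℝ) • w (s, x)) ∂μ := by
  have hbij := bijective_add_smul hC hτ
  have := integral_image_eq_integral_abs_det_fderiv_smul μ MeasurableSet.univ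
    (f := fun x => x + (τ : ℝ) • w (s, x)) (f' := fun x => 1 + (τ : ℝ) • A (s, x))
    (fun x _ => ((hasFDerivAt_id x).add
      ((h.hasFDerivAt_field s hs x).const_smul (τ : ℝ))).hasFDerivWithinAt)
    hbij.injective.injOn f
  simpa [image_univ, hbij.surjective.range_eq] using this

omit [FiniteDimensional ℝ E] [MeasurableSpace E] [BorelSpace E] in
theorem continuous_density (h : IsCompactTransport w A g B S) {s : ℝ} (hs : s ∈ Icc (0:ℝ) 1) :
    Continuous (fun x => g (s, x)) :=
  h.continuousOn_density.comp_continuous (by fun_prop) fun _ => ⟨hs, trivial⟩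

omit [FiniteDimensional ℝ E] [MeasurableSpace E] [BorelSpace E] in
theorem hasCompactSupport_density (h : IsCompactTransport w A g B S) {s : ℝ}
    (hs : s ∈ Icc (0:ℝ) 1) : HasCompactSupport (fun x => g (s, x)) :=
  HasCompactSupport.intro h.isCompact fun x hx => h.density_eq_zero s hs x hx

omit [FiniteDimensional ℝ E] in
theorem integrable_mul_density (h : IsCompactTransport w A g B S) {s : ℝ}
    (hs : s ∈ Icc (0:ℝ) 1) {φ : E → ℝ} (hφ : Continuous φ) :
    Integrable (fun x => φ x * g (s, x)) μ :=
  (hφ.mul (h.continuous_density hs)).integrable_of_hasCompactSupport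
    ((h.hasCompactSupport_density hs).mul_left)

/-- `X` follows the field `w` from the points where the initial density is nonzero, staying
in `S`. -/
structure IsFlow (w : ℝ × E → E) (g : ℝ × E → ℝ) (S : Set E) (X : ℝ → E → E) : Prop where
  initial : ∀ x, X 0 x = x
  mem : ∀ x, g (0, x) ≠ 0 → ∀ s ∈ Icc (0:ℝ) 1, X s x ∈ S
  hasDerivWithinAt : ∀ x, g (0, x) ≠ 0 → ∀ s ∈ Icc (0:ℝ) 1,
    HasDerivWithinAt (fun r => X r x) (w (s, X s x)) (Icc 0 1) s

variable {X : ℝ → E → E}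

omit [FiniteDimensional ℝ E] [MeasurableSpace E] [BorelSpace E] in
theorem continuousOn_flow (h : IsCompactTransport w A g B S) (hX : IsFlow w g S X) {t : ℝ}
    (ht : t ∈ Icc (0:ℝ) 1) : ContinuousOn (X t) {x | g (0, x) ≠ 0} := by
  obtain ⟨C, hC⟩ := h.exists_lipschitzWith_field
  have hr : ∀ x, g (0, x) ≠ 0 → ∀ s ∈ Ico (0:ℝ) 1,
      HasDerivWithinAt (fun r => X r x) (w (s, X s x)) (Ici s) s := fun x hx s hs =>
    (hX.hasDerivWithinAt x hx s (Ico_subset_Icc_self hs)).mono_of_mem_nhdsWithin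
      (Icc_mem_nhdsGE_of_mem hs)
  have hc : ∀ x, g (0, x) ≠ 0 → ContinuousOn (fun r => X r x) (Icc 0 1) := fun x hx s hs =>
    (hX.hasDerivWithinAt x hx s hs).continuousWithinAt
  have hlip : LipschitzOnWith (Real.exp (C * t)).toNNReal (X t) {x | g (0, x) ≠ 0} := by
    refine LipschitzOnWith.of_dist_le_mul fun x hx y hy => ?_
    have := dist_le_of_trajectories_ODE_of_mem (v := fun s y => w (s, y)) (s := fun _ => univ)
      (δ := dist x y)
      (fun s hs => (hC s (Ico_subset_Icc_self hs)).lipschitzOnWith) (hc x hx) (hr x hx)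
      (fun _ _ => trivial) (hc y hy) (hr y hy) (fun _ _ => trivial)
      (by rw [hX.initial, hX.initial]) t ht
    rw [Real.coe_toNNReal _ (Real.exp_pos _).le, mul_comm]
    simpa using this
  exact hlip.continuousOn

omit [FiniteDimensional ℝ E] in
theorem integrable_comp_flow_mul_density (h : IsCompactTransport w A g B S)
    (hX : IsFlow w g S X) {t : ℝ} (ht : t ∈ Icc (0:ℝ) 1) {φ : E → ℝ} (hφ : Continuous φ) {M : ℝ}
    (hM : ∀ x, |φ x| ≤ M) : Integrable (fun x => φ (X t x) * g (0, x)) μ := by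
  have h0 : (0:ℝ) ∈ Icc (0:ℝ) 1 := ⟨le_rfl, zero_le_one⟩
  have hU : MeasurableSet {x | g (0, x) ≠ 0} :=
    ((h.continuous_density h0).measurable (measurableSet_singleton 0)).compl
  have hmeas : AEStronglyMeasurable (fun x => φ (X t x) * g (0, x)) μ := by
    have h1 : ContinuousOn (fun x => φ (X t x) * g (0, x)) {x | g (0, x) ≠ 0} :=
      (hφ.comp_continuousOn (h.continuousOn_flow hX ht)).mul (h.continuous_density h0).continuousOn
    have h2 := (aestronglyMeasurable_indicator_iff hU).2 (h1.aestronglyMeasurable (μ := μ) hU)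
    convert h2 using 1
    refine (indicator_eq_self.2 fun x hx => ?_).symm
    exact right_ne_zero_of_mul hx
  have hg : Integrable (fun x => M * g (0, x)) μ := h.integrable_mul_density μ h0 continuous_const
  refine hg.mono' hmeas (Filter.Eventually.of_forall fun x => ?_)
  rw [norm_mul, Real.norm_eq_abs, Real.norm_of_nonneg (h.density_nonneg 0 h0 x)]
  exact mul_le_mul_of_nonneg_right (hM _) (h.density_nonneg 0 h0 x)

theorem step_estimate (h : IsCompactTransport w A g B S) (hX : IsFlow w g S X)
    {C : NNReal} (hC : ∀ s ∈ Icc (0:ℝ) 1, LipschitzWith C (fun y => w (s, y)))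
    {ε : ℝ} (hε : 0 < ε) :
    ∃ δ : ℝ, 0 < δ ∧ ∀ (s : ℝ) (τ : NNReal), 0 ≤ s → s + τ ≤ 1 → τ < δ → ∀ (L : NNReal) (M : ℝ)
      (ψ : E → ℝ), LipschitzWith L ψ → (∀ x, |ψ x| ≤ M) →
      |∫ x, ψ (X (s + τ) x) * g (0, x) ∂μ - ∫ y, ψ y * g (s + τ, y) ∂μ| ≤
        |∫ x, ψ (X s x + (τ : ℝ) • w (s, X s x)) * g (0, x) ∂μ
          - ∫ y, ψ (y + (τ : ℝ) • w (s, y)) * g (s, y) ∂μ|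
        + ε * τ * (L * ∫ x, g (0, x) ∂μ + M * μ.real S) := by
  obtain ⟨δ₁, hδ₁, H₁⟩ := h.jacobian_estimate hε
  obtain ⟨δ₂, hδ₂, H₂⟩ := h.euler_estimate hε
  refine ⟨min (min δ₁ δ₂) (1 / (C + 1)), by positivity, ?_⟩
  intro s τ hs hsτ hτ L M ψ hψ hM
  rw [lt_min_iff, lt_min_iff, lt_div_iff₀ (by positivity)] at hτ
  obtain ⟨⟨hτ₁, hτ₂⟩, hτ₃⟩ := hτ
  have h0 : (0:ℝ) ∈ Icc (0:ℝ) 1 := ⟨le_rfl, zero_le_one⟩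
  have hτ0 : (0:ℝ) ≤ τ := τ.coe_nonneg
  have hsI : s ∈ Icc (0:ℝ) 1 := ⟨hs, by linarith⟩
  have hsτI : s + τ ∈ Icc (0:ℝ) 1 := ⟨by linarith, hsτ⟩
  have hτC : τ * C < 1 := by
    rw [← NNReal.coe_lt_coe, NNReal.coe_mul, NNReal.coe_one]
    nlinarith
  have hEc : Continuous (fun y => y + (τ : ℝ) • w (s, y)) :=
    (lipschitzWith_add_smul (hC s hsI) τ).continuous
  have hψE : Continuous (fun y => ψ (y + (τ : ℝ) • w (s, y))) := hψ.continuous.comp hEc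
  have hI1 := h.integrable_comp_flow_mul_density μ hX hsτI hψ.continuous hM
  have hI2 := h.integrable_comp_flow_mul_density μ hX hsI hψE (fun _ => hM _)
  have e1 : |∫ x, ψ (X (s + τ) x) * g (0, x) ∂μ
      - ∫ x, ψ (X s x + (τ : ℝ) • w (s, X s x)) * g (0, x) ∂μ|
      ≤ ε * τ * (L * ∫ x, g (0, x) ∂μ) := by
    rw [← integral_sub hI1 hI2, ← Real.norm_eq_abs, ← mul_assoc, ← integral_const_mul]
    refine norm_integral_le_of_norm_le (h.integrable_mul_density μ h0 continuous_const)
      (Filter.Eventually.of_forall fun x => ?_)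
    by_cases hx : g (0, x) = 0
    · simp [hx]
    rw [← sub_mul, norm_mul, Real.norm_of_nonneg (h.density_nonneg 0 h0 x)]
    refine mul_le_mul_of_nonneg_right ?_ (h.density_nonneg 0 h0 x)
    rw [← dist_eq_norm]
    refine (hψ.dist_le_mul _ _).trans ?_
    rw [dist_eq_norm, mul_comm]
    exact mul_le_mul_of_nonneg_right (H₂ s τ hs hτ0 hsτ hτ₂ (fun r => X r x) (hX.mem x hx)
      (hX.hasDerivWithinAt x hx)) L.coe_nonneg
  have e2 : |∫ y, ψ y * g (s + τ, y) ∂μ - ∫ y, ψ (y + (τ : ℝ) • w (s, y)) * g (s, y) ∂μ|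
      ≤ ε * τ * (M * μ.real S) := by
    have hmap : Continuous fun x => |(1 + (τ : ℝ) • A (s, x)).det| := by
      have hAs : Continuous fun x => A (s, x) :=
        h.continuousOn_fderiv_field.comp_continuous (continuous_const.prodMk continuous_id)
          fun _ => ⟨hsI, trivial⟩
      exact (ContinuousLinearMap.continuous_det.comp
        (continuous_const.add (hAs.const_smul (τ : ℝ)))).abs
    have hzero : ∀ x ∉ S, g (s + τ, x + (τ : ℝ) • w (s, x)) = 0 := fun x hx => by
      rw [h.field_eq_zero s hsI x hx, smul_zero, add_zero, h.density_eq_zero _ hsτI x hx]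
    have hI3 : Integrable (fun x => |(1 + (τ : ℝ) • A (s, x)).det| *
        (ψ (x + (τ : ℝ) • w (s, x)) * g (s + τ, x + (τ : ℝ) • w (s, x)))) μ := by
      refine (hmap.mul (hψE.mul
        ((h.continuous_density hsτI).comp hEc))).integrable_of_hasCompactSupport ?_
      refine HasCompactSupport.intro h.isCompact fun x hx => ?_
      simp [hzero x hx]
    rw [h.integral_eq_integral_euler μ hsI (hC s hsI) hτC (fun y => ψ y * g (s + τ, y)),
      ← integral_sub hI3 (h.integrable_mul_density μ hsI hψE)]
    have hb : ∀ x ∈ S, ‖|(1 + (τ : ℝ) • A (s, x)).det| *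
        (ψ (x + (τ : ℝ) • w (s, x)) * g (s + τ, x + (τ : ℝ) • w (s, x)))
        - ψ (x + (τ : ℝ) • w (s, x)) * g (s, x)‖ ≤ ε * τ * M := by
      intro x hx
      rw [mul_left_comm, ← mul_sub, norm_mul, mul_comm]
      exact mul_le_mul (H₁ s τ hs hτ0 hsτ hτ₁ x hx) (hM _) (norm_nonneg _) (by positivity)
    rw [← setIntegral_eq_integral_of_forall_compl_eq_zero (s := S), ← Real.norm_eq_abs, ← mul_assoc]
    · exact norm_setIntegral_le_of_norm_le_const h.isCompact.measure_lt_top hb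
    · intro x hx
      simp [hzero x hx, h.density_eq_zero s hsI x hx]
  rw [abs_le] at e1 e2 ⊢
  set a := ∫ x, ψ (X s x + (τ : ℝ) • w (s, X s x)) * g (0, x) ∂μ
  set b := ∫ y, ψ (y + (τ : ℝ) • w (s, y)) * g (s, y) ∂μ
  have h1 := le_abs_self (a - b)
  have h2 := neg_abs_le (a - b)
  rw [mul_add]
  constructor <;> linarith [e1.1, e1.2, e2.1, e2.2]

theorem integral_comp_flow_of_lipschitz (h : IsCompactTransport w A g B S) (hX : IsFlow w g S X)
    {t : ℝ} (ht : t ∈ Icc (0:ℝ) 1) {L : NNReal} {M : ℝ} {ψ : E → ℝ} (hψ : LipschitzWith L ψ)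
    (hM : ∀ x, |ψ x| ≤ M) :
    ∫ x, ψ (X t x) * g (0, x) ∂μ = ∫ y, ψ y * g (t, y) ∂μ := by
  obtain ⟨C, hC⟩ := h.exists_lipschitzWith_field
  have h0 : (0:ℝ) ∈ Icc (0:ℝ) 1 := ⟨le_rfl, zero_le_one⟩
  set m := ∫ x, g (0, x) ∂μ
  have hm : 0 ≤ m := integral_nonneg fun x => h.density_nonneg 0 h0 x
  have hM0 : 0 ≤ M := (abs_nonneg _).trans (hM 0)
  set R := (L : ℝ) * Real.exp C * m + M * μ.real S
  have hR : 0 ≤ R :=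
    add_nonneg (mul_nonneg (by positivity) hm) (mul_nonneg hM0 measureReal_nonneg)
  have key : ∀ ε > 0, |∫ x, ψ (X t x) * g (0, x) ∂μ - ∫ y, ψ y * g (t, y) ∂μ| ≤ ε * R := by
    intro ε hε
    obtain ⟨δ, hδ, H⟩ := h.step_estimate μ hX hC hε
    obtain ⟨n, hn⟩ := exists_nat_gt (1 / δ)
    have hn0 : (0:ℝ) < n := lt_trans (by positivity) hn
    set τ : NNReal := ⟨t / n, div_nonneg ht.1 hn0.le⟩
    have hτ : (τ : ℝ) = t / n := rfl
    have hτδ : (τ : ℝ) < δ := by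
      rw [hτ, div_lt_iff₀ hn0]
      rw [div_lt_iff₀ hδ] at hn
      nlinarith [ht.2]
    have hnτ : n * (τ : ℝ) = t := by rw [hτ]; field_simp
    have ind : ∀ k : ℕ, k ≤ n → ∀ (L : NNReal) (ψ : E → ℝ), LipschitzWith L ψ →
        (∀ x, |ψ x| ≤ M) →
        |∫ x, ψ (X (k * τ) x) * g (0, x) ∂μ - ∫ y, ψ y * g (k * τ, y) ∂μ| ≤
          ε * (k * τ) * ((L * (1 + τ * C) ^ k) * m + M * μ.real S) := by
      intro k
      induction k with
      | zero =>
        intro _ L ψ _ _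
        simp [hX.initial]
      | succ k ih =>
        intro hk L ψ hψ hM
        have hkn : ((k : ℝ) + 1) * τ ≤ t := by
          rw [← hnτ]
          exact mul_le_mul_of_nonneg_right (by exact_mod_cast hk) τ.coe_nonneg
        have hkτ : (k : ℝ) * τ ∈ Icc (0:ℝ) 1 :=
          ⟨by positivity, by nlinarith [ht.2, τ.coe_nonneg]⟩
        have h1 := H (k * τ) τ hkτ.1 (by nlinarith [ht.2]) hτδ L M ψ hψ hM
        have h2 := ih (by omega) _ _ (hψ.comp (lipschitzWith_add_smul (hC _ hkτ) τ))
          (fun _ => hM _)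
        simp only [Function.comp_apply] at h2
        have e : ((k + 1 : ℕ) : ℝ) * τ = k * τ + τ := by push_cast; ring
        rw [e]
        refine h1.trans ((add_le_add_left h2 _).trans ?_)
        have hpow : (1:ℝ) ≤ (1 + τ * C) ^ (k + 1) :=
          one_le_pow₀ (by linarith [mul_nonneg τ.coe_nonneg C.coe_nonneg])
        have hL : (L : ℝ) ≤ L * (1 + τ * C) ^ (k + 1) :=
          le_mul_of_one_le_right L.coe_nonneg hpow
        have h3 : ε * τ * (L * m + M * μ.real S) ≤
            ε * τ * ((L * (1 + τ * C) ^ (k + 1)) * m + M * μ.real S) := by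
          gcongr
        calc _ ≤ _ := add_le_add_right h3 _
          _ = _ := by push_cast; ring
    have := ind n le_rfl L ψ hψ hM
    rw [hnτ] at this
    refine this.trans ?_
    have hexp : (1 + (τ : ℝ) * C) ^ n ≤ Real.exp C := by
      have h1 : 1 + (τ : ℝ) * C ≤ Real.exp (τ * C) := by
        linarith [Real.add_one_le_exp ((τ : ℝ) * C)]
      calc (1 + (τ : ℝ) * C) ^ n ≤ Real.exp (τ * C) ^ n := by gcongr
        _ = Real.exp (t * C) := by rw [← Real.exp_nat_mul, ← mul_assoc, hnτ]
        _ ≤ Real.exp C := Real.exp_le_exp.2 (mul_le_of_le_one_left C.coe_nonneg ht.2)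
    calc ε * t * ((L * (1 + τ * C) ^ n) * m + M * μ.real S) ≤ ε * 1 * R := by
          have := ht.2
          simp only [R]
          gcongr
      _ = ε * R := by ring
  refine sub_eq_zero.1 (abs_nonpos_iff.1 (le_of_forall_pos_le_add fun η hη => ?_))
  rw [zero_add]
  refine (key (η / (R + 1)) (by positivity)).trans ?_
  rw [div_mul_eq_mul_div, div_le_iff₀ (by positivity)]
  nlinarith

theorem integral_comp_flow (h : IsCompactTransport w A g B S) (hX : IsFlow w g S X)
    {t : ℝ} (ht : t ∈ Icc (0:ℝ) 1) {φ : E → ℝ} (hφ : Continuous φ) :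
    ∫ x, φ (X t x) * g (0, x) ∂μ = ∫ y, φ y * g (t, y) ∂μ := by
  have h0 : (0:ℝ) ∈ Icc (0:ℝ) 1 := ⟨le_rfl, zero_le_one⟩
  obtain ⟨R, hR0, hR⟩ := h.isCompact.isBounded.subset_closedBall_lt 0 0
  let f : ContDiffBump (0 : E) := ⟨R, R + 1, hR0, by linarith⟩
  have hf : ∀ x ∈ S, f x = 1 := fun x hx => f.one_of_mem_closedBall (hR hx)
  set φ' : E → ℝ := fun x => f x * φ x with hφ'
  have hφ'c : Continuous φ' := f.continuous.mul hφ
  have hφ's : HasCompactSupport φ' := f.hasCompactSupport.mul_right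
  have e1 : ∫ x, φ (X t x) * g (0, x) ∂μ = ∫ x, φ' (X t x) * g (0, x) ∂μ := by
    congr 1 with x
    by_cases hx : g (0, x) = 0
    · simp [hx]
    · simp [hφ', hf _ (hX.mem x hx t ht)]
  have e2 : ∫ x, φ x * g (t, x) ∂μ = ∫ x, φ' x * g (t, x) ∂μ := by
    congr 1 with x
    by_cases hx : x ∈ S
    · simp [hφ', hf _ hx]
    · simp [h.density_eq_zero t ht x hx]
  rw [e1, e2]
  obtain ⟨M, hM⟩ := hφ's.exists_bound_of_continuous hφ'c
  set m := ∫ x, g (0, x) ∂μ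
  set m' := ∫ x, g (t, x) ∂μ
  have hm : 0 ≤ m := integral_nonneg fun x => h.density_nonneg 0 h0 x
  have hm' : 0 ≤ m' := integral_nonneg fun x => h.density_nonneg t ht x
  have key : ∀ ε > 0, |∫ x, φ' (X t x) * g (0, x) ∂μ - ∫ y, φ' y * g (t, y) ∂μ|
      ≤ ε * m + ε * m' := by
    intro ε hε
    obtain ⟨ψ, hψ, hψφ, hψs⟩ := hφ'c.exists_contDiff_approx 1 (ε := fun _ => ε)
      continuous_const fun _ => hε
    have hψc : HasCompactSupport ψ := hφ's.mono hψs
    obtain ⟨L, hL⟩ := hψ.lipschitzWith_of_hasCompactSupport hψc (by simp)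
    obtain ⟨M', hM'⟩ := hψc.exists_bound_of_continuous hψ.continuous
    have heq := h.integral_comp_flow_of_lipschitz μ hX ht hL hM'
    have b1 : |∫ x, φ' (X t x) * g (0, x) ∂μ - ∫ x, ψ (X t x) * g (0, x) ∂μ| ≤ ε * m := by
      rw [← integral_sub (h.integrable_comp_flow_mul_density μ hX ht hφ'c hM)
        (h.integrable_comp_flow_mul_density μ hX ht hψ.continuous hM'), ← integral_const_mul,
        ← Real.norm_eq_abs]
      refine norm_integral_le_of_norm_le (h.integrable_mul_density μ h0 continuous_const)
        (Filter.Eventually.of_forall fun x => ?_)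
      rw [← sub_mul, norm_mul, Real.norm_of_nonneg (h.density_nonneg 0 h0 x), ← dist_eq_norm,
        dist_comm]
      exact mul_le_mul_of_nonneg_right (hψφ _).le (h.density_nonneg 0 h0 x)
    have b2 : |∫ x, φ' x * g (t, x) ∂μ - ∫ x, ψ x * g (t, x) ∂μ| ≤ ε * m' := by
      rw [← integral_sub (h.integrable_mul_density μ ht hφ'c)
        (h.integrable_mul_density μ ht hψ.continuous), ← integral_const_mul, ← Real.norm_eq_abs]
      refine norm_integral_le_of_norm_le (h.integrable_mul_density μ ht continuous_const)
        (Filter.Eventually.of_forall fun x => ?_)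
      rw [← sub_mul, norm_mul, Real.norm_of_nonneg (h.density_nonneg t ht x), ← dist_eq_norm,
        dist_comm]
      exact mul_le_mul_of_nonneg_right (hψφ _).le (h.density_nonneg t ht x)
    rw [abs_le] at b1 b2 ⊢
    constructor <;> linarith [b1.1, b1.2, b2.1, b2.2]
  refine sub_eq_zero.1 (abs_nonpos_iff.1 (le_of_forall_pos_le_add fun η hη => ?_))
  rw [zero_add]
  refine (key (η / (m + m' + 1)) (by positivity)).trans ?_
  rw [← mul_add, div_mul_eq_mul_div, div_le_iff₀ (by positivity)]
  nlinarith

end IsCompactTransport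

end Jacobian

section Slices

variable {E F : Type*} [NormedAddCommGroup E] [NormedSpace ℝ E] [NormedAddCommGroup F]
  [NormedSpace ℝ F] {f : ℝ × E → F} {f' : ℝ × E →L[ℝ] F} {I : Set ℝ} {t : ℝ} {x : E}

theorem HasFDerivWithinAt.hasFDerivAt_slice (h : HasFDerivWithinAt f f' (I ×ˢ univ) (t, x))
    (ht : t ∈ I) :
    HasFDerivAt (fun y => f (t, y)) (f'.comp (ContinuousLinearMap.inr ℝ ℝ E)) x := by
  have hmaps : MapsTo (fun y => (t, y)) (univ : Set E) (I ×ˢ univ) := fun _ _ => ⟨ht, trivial⟩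
  have h1 := h.comp x (hasFDerivAt_prodMk_right (𝕜 := ℝ) t x).hasFDerivWithinAt hmaps
  exact hasFDerivWithinAt_univ.1 h1

theorem HasFDerivWithinAt.hasDerivWithinAt_slice
    (h : HasFDerivWithinAt f f' (I ×ˢ univ) (t, x)) :
    HasDerivWithinAt (fun s => f (s, x)) (f' (1, 0)) I t := by
  have hmaps : MapsTo (fun s : ℝ => (s, x)) I (I ×ˢ univ) := fun _ hs => ⟨hs, trivial⟩
  exact h.comp_hasDerivWithinAt t
    ((hasDerivWithinAt_id t I).prodMk (hasDerivWithinAt_const t I x)) hmaps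

end Slices

theorem uniqueDiffOn_Icc_prod_univ {E : Type*} [NormedAddCommGroup E] [NormedSpace ℝ E] :
    UniqueDiffOn ℝ (Icc (0:ℝ) 1 ×ˢ (univ : Set E)) :=
  (uniqueDiffOn_Icc zero_lt_one).prod uniqueDiffOn_univ

/-- The nondivergence form `∂_t g + Dg · u + g tr (D u) = 0` of the continuity equation. -/
theorem continuity_eq_nondivergence {d : ℕ} {g : ℝ × EuclideanSpace ℝ (Fin d) → ℝ}
    {u : ℝ × EuclideanSpace ℝ (Fin d) → EuclideanSpace ℝ (Fin d)} {t : ℝ}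
    {x : EuclideanSpace ℝ (Fin d)} (ht : t ∈ Icc (0:ℝ) 1)
    {g' : ℝ × EuclideanSpace ℝ (Fin d) →L[ℝ] ℝ}
    (hg : HasFDerivWithinAt g g' (Icc (0:ℝ) 1 ×ˢ univ) (t, x))
    {u' : EuclideanSpace ℝ (Fin d) →L[ℝ] EuclideanSpace ℝ (Fin d)}
    (hu : HasFDerivAt (fun y => u (t, y)) u' x)
    (hcont : derivWithin (fun s => g (s, x)) (Icc (0:ℝ) 1) t +
        ∑ i : Fin d,
          fderiv ℝ (fun y => g (t, y) * u (t, y) i) x (EuclideanSpace.single i 1) = 0) :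
    g' (1, u (t, x)) + g (t, x) * LinearMap.trace ℝ (EuclideanSpace ℝ (Fin d)) u' = 0 := by
  rw [hg.hasDerivWithinAt_slice.derivWithin (uniqueDiffOn_Icc zero_lt_one t ht)] at hcont
  have hgx := hg.hasFDerivAt_slice ht
  have hi : ∀ i, fderiv ℝ (fun y => g (t, y) * u (t, y) i) x (EuclideanSpace.single i 1) =
      g (t, x) * u' (EuclideanSpace.single i 1) i
        + u (t, x) i * g' (0, EuclideanSpace.single i 1) := by
    intro i
    have h1 : HasFDerivAt (fun y => u (t, y) i)
        ((EuclideanSpace.proj i : EuclideanSpace ℝ (Fin d) →L[ℝ] ℝ).comp u') x :=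
      (EuclideanSpace.proj i : EuclideanSpace ℝ (Fin d) →L[ℝ] ℝ).hasFDerivAt.comp x hu
    have h2 : HasFDerivAt (fun y => g (t, y) * u (t, y) i) _ x := hgx.mul h1
    rw [h2.fderiv]
    simp
  simp_rw [hi] at hcont
  rw [Finset.sum_add_distrib, ← Finset.mul_sum] at hcont
  have htr : LinearMap.trace ℝ (EuclideanSpace ℝ (Fin d)) u' =
      ∑ i, u' (EuclideanSpace.single i 1) i := by
    rw [LinearMap.trace_eq_sum_inner _ (EuclideanSpace.basisFun (Fin d) ℝ)]
    simp [EuclideanSpace.inner_single_left]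
  have hdec : g' (1, u (t, x)) = g' (1, 0) +
      ∑ i, u (t, x) i * g' (0, EuclideanSpace.single i 1) := by
    have h1 : ((1 : ℝ), u (t, x)) = (1, 0) + ContinuousLinearMap.inr ℝ ℝ _ (u (t, x)) := by simp
    have h2 := (EuclideanSpace.basisFun (Fin d) ℝ).sum_repr (u (t, x))
    rw [h1, map_add]
    conv_lhs => rw [← h2]
    rw [map_sum, map_sum]
    congr 1
    refine Finset.sum_congr rfl fun i _ => ?_
    rw [map_smul, map_smul]
    simp
  rw [htr, hdec]
  linarith

/-- A density solving the continuity equation stays positive along trajectories of the field. -/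
theorem density_pos_along_trajectory {E : Type*} [NormedAddCommGroup E] [NormedSpace ℝ E]
    {v : ℝ × E → E} {g c : ℝ × E → ℝ} {g' : ℝ × E → ℝ × E →L[ℝ] ℝ}
    (hg : ∀ p ∈ Icc (0:ℝ) 1 ×ˢ (univ : Set E),
      HasFDerivWithinAt g (g' p) (Icc (0:ℝ) 1 ×ˢ univ) p)
    (hg0 : ∀ s ∈ Icc (0:ℝ) 1, ∀ x, 0 ≤ g (s, x))
    (hc : ContinuousOn c (Icc (0:ℝ) 1 ×ˢ univ))
    (hpde : ∀ s ∈ Icc (0:ℝ) 1, ∀ x, g' (s, x) (1, v (s, x)) + g (s, x) * c (s, x) = 0)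
    {γ : ℝ → E} (hγ : ∀ s ∈ Icc (0:ℝ) 1, HasDerivWithinAt γ (v (s, γ s)) (Icc 0 1) s)
    (hpos : 0 < g (0, γ 0)) {t : ℝ} (ht : t ∈ Icc (0:ℝ) 1) : 0 < g (t, γ t) := by
  have hmaps : MapsTo (fun s => (s, γ s)) (Icc (0:ℝ) 1) (Icc (0:ℝ) 1 ×ˢ univ) :=
    fun s hs => ⟨hs, trivial⟩
  have hγc : ContinuousOn (fun s => (s, γ s)) (Icc (0:ℝ) 1) :=
    continuousOn_id.prodMk fun s hs => (hγ s hs).continuousWithinAt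
  obtain ⟨C, hC⟩ := isCompact_Icc.exists_bound_of_continuousOn (hc.comp hγc hmaps)
  have hder : ∀ s ∈ Icc (0:ℝ) 1, HasDerivWithinAt (fun s => g (s, γ s) * Real.exp (C * s))
      (g (s, γ s) * Real.exp (C * s) * (C - c (s, γ s))) (Icc 0 1) s := by
    intro s hs
    have h1 := (hg (s, γ s) (hmaps hs)).comp_hasDerivWithinAt s
      ((hasDerivWithinAt_id s _).prodMk (hγ s hs)) hmaps
    have h2 : HasDerivAt (fun s => Real.exp (C * s)) (Real.exp (C * s) * C) s := by
      simpa using ((hasDerivAt_id s).const_mul C).exp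
    refine (h1.mul h2.hasDerivWithinAt).congr_deriv ?_
    have := hpde s hs (γ s)
    simp only [Function.comp_apply, id_eq]
    linear_combination Real.exp (C * s) * this
  have hmono : MonotoneOn (fun s => g (s, γ s) * Real.exp (C * s)) (Icc 0 1) := by
    refine monotoneOn_of_hasDerivWithinAt_nonneg (convex_Icc 0 1)
      (fun s hs => (hder s hs).continuousWithinAt)
      (fun s hs => (hder s (interior_subset hs)).mono interior_subset) fun s hs => ?_
    have hs' := interior_subset hs
    have h1 := (abs_le.1 (hC s hs')).2
    simp only [Function.comp_apply] at h1
    exact mul_nonneg (mul_nonneg (hg0 s hs' _) (Real.exp_pos _).le) (sub_nonneg.2 h1)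
  have h1 := hmono ⟨le_rfl, zero_le_one⟩ ht ht.1
  simp only [mul_zero, Real.exp_zero, mul_one] at h1
  exact pos_of_mul_pos_left (hpos.trans_le h1) (Real.exp_pos _).le

/-- if `X` is the flow of a `C¹` vector field `v` on `[0,1] × ℝ^d` and the
nonnegative `C¹` function `g`, compactly supported in space, solves the continuity
equation `∂_t g + div_x(g v) = 0`, then `X(t,·)` pushes `g(0,·) dx` forward to
`g(t,·) dx`: for every bounded continuous `φ`,
`∫ φ(X(t,x)) g(0,x) dx = ∫ φ(y) g(t,y) dy`. -/
theorem stmt_9 {d : ℕ} (hd : 1 ≤ d)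
    (v : ℝ × EuclideanSpace ℝ (Fin d) → EuclideanSpace ℝ (Fin d))
    (hv : ContDiffOn ℝ 1 v (Icc (0:ℝ) 1 ×ˢ (univ : Set (EuclideanSpace ℝ (Fin d)))))
    (X : ℝ → EuclideanSpace ℝ (Fin d) → EuclideanSpace ℝ (Fin d))
    (hXflow : ∀ t ∈ Icc (0:ℝ) 1, ∀ x : EuclideanSpace ℝ (Fin d),
      HasDerivWithinAt (fun s => X s x) (v (t, X t x)) (Icc (0:ℝ) 1) t)
    (hX0 : ∀ x : EuclideanSpace ℝ (Fin d), X 0 x = x)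
    (g : ℝ × EuclideanSpace ℝ (Fin d) → ℝ)
    (hg : ContDiffOn ℝ 1 g (Icc (0:ℝ) 1 ×ˢ (univ : Set (EuclideanSpace ℝ (Fin d)))))
    (hg_nonneg : ∀ t ∈ Icc (0:ℝ) 1, ∀ x : EuclideanSpace ℝ (Fin d), 0 ≤ g (t, x))
    (hcontinuity : ∀ t ∈ Icc (0:ℝ) 1, ∀ x : EuclideanSpace ℝ (Fin d),
      derivWithin (fun s => g (s, x)) (Icc (0:ℝ) 1) t +
        ∑ i : Fin d,
          fderiv ℝ (fun y => g (t, y) * v (t, y) i) x (EuclideanSpace.single i 1) = 0)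
    (K : Set (EuclideanSpace ℝ (Fin d))) (hK : IsCompact K)
    (hsupp : ∀ t ∈ Icc (0:ℝ) 1, ∀ x ∉ K, g (t, x) = 0) :
    ∀ t ∈ Icc (0:ℝ) 1, ∀ φ : EuclideanSpace ℝ (Fin d) → ℝ,
      Continuous φ → (∃ M : ℝ, ∀ x, |φ x| ≤ M) →
      ∫ x : EuclideanSpace ℝ (Fin d), φ (X t x) * g (0, x) =
        ∫ y : EuclideanSpace ℝ (Fin d), φ y * g (t, y) := by
  intro t ht φ hφ _
  set I : Set (ℝ × EuclideanSpace ℝ (Fin d)) := Icc (0:ℝ) 1 ×ˢ univ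
  have hI : UniqueDiffOn ℝ I := uniqueDiffOn_Icc_prod_univ
  have h0 : (0:ℝ) ∈ Icc (0:ℝ) 1 := ⟨le_rfl, zero_le_one⟩
  obtain ⟨R, hR0, hR⟩ := hK.isBounded.subset_closedBall_lt 0 0
  let f : ContDiffBump (0 : EuclideanSpace ℝ (Fin d)) := ⟨R, R + 1, hR0, by linarith⟩
  have hf : ∀ x ∈ K, f x = 1 := fun x hx => f.one_of_mem_closedBall (hR hx)
  have hKS : K ⊆ Metric.closedBall 0 (R + 1) :=
    hR.trans (Metric.closedBall_subset_closedBall (by linarith))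
  set w : ℝ × EuclideanSpace ℝ (Fin d) → EuclideanSpace ℝ (Fin d) := fun p => f p.2 • v p with hw
  have hwc : ContDiffOn ℝ 1 w I :=
    (f.contDiff.comp contDiff_snd).contDiffOn.smul hv
  have hg' : ∀ p ∈ I, HasFDerivWithinAt g (fderivWithin ℝ g I p) I p := fun p hp =>
    (hg.differentiableOn one_ne_zero p hp).hasFDerivWithinAt
  have slice : ∀ u : ℝ × EuclideanSpace ℝ (Fin d) → EuclideanSpace ℝ (Fin d), ContDiffOn ℝ 1 u I →
      ∀ s ∈ Icc (0:ℝ) 1, ∀ x, HasFDerivAt (fun y => u (s, y))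
        ((fderivWithin ℝ u I (s, x)).comp (ContinuousLinearMap.inr ℝ ℝ _)) x :=
    fun u hu s hs x => HasFDerivWithinAt.hasFDerivAt_slice
      (hu.differentiableOn one_ne_zero (s, x) ⟨hs, trivial⟩).hasFDerivWithinAt hs
  have slicec : ∀ u : ℝ × EuclideanSpace ℝ (Fin d) → EuclideanSpace ℝ (Fin d),
      ContDiffOn ℝ 1 u I → ContinuousOn (fun p =>
        (fderivWithin ℝ u I p).comp (ContinuousLinearMap.inr ℝ ℝ (EuclideanSpace ℝ (Fin d)))) I :=
    fun u hu => (hu.continuousOn_fderivWithin hI le_rfl).clm_comp continuousOn_const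
  have hgw : ∀ s ∈ Icc (0:ℝ) 1, ∀ y, g (s, y) • w (s, y) = g (s, y) • v (s, y) := by
    intro s hs y
    by_cases hy : y ∈ K
    · simp [hw, hf y hy]
    · simp [hsupp s hs y hy]
  have htransport : IsCompactTransport w (fun p => (fderivWithin ℝ w I p).comp
      (ContinuousLinearMap.inr ℝ ℝ _)) g (fderivWithin ℝ g I) (Metric.closedBall 0 (R + 1)) :=
    { isCompact := isCompact_closedBall _ _
      hasFDerivAt_field := slice w hwc
      continuousOn_field := hwc.continuousOn
      continuousOn_fderiv_field := slicec w hwc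
      field_eq_zero := fun s _ x hx => by
        have : f x = 0 := f.zero_of_le_dist (not_le.1 hx).le
        simp [hw, this]
      hasFDerivWithinAt_density := hg'
      continuousOn_fderiv_density := hg.continuousOn_fderivWithin hI le_rfl
      density_eq_zero := fun s hs x hx => hsupp s hs x fun h => hx (hKS h)
      density_nonneg := hg_nonneg
      continuity_eq := fun s hs x => by
        refine continuity_eq_nondivergence hs (hg' _ ⟨hs, trivial⟩) (slice w hwc s hs x) ?_
        have hflux : ∀ i, (fun y => g (s, y) * w (s, y) i) = fun y => g (s, y) * v (s, y) i :=
          fun i => funext fun y =>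
            congrArg (fun z : EuclideanSpace ℝ (Fin d) => z i) (hgw s hs y)
        simp_rw [hflux]
        exact hcontinuity s hs x }
  have hpos : ∀ x, g (0, x) ≠ 0 → ∀ s ∈ Icc (0:ℝ) 1, X s x ∈ K := by
    intro x hx s hs
    by_contra hK'
    have hc : ContinuousOn (fun p => LinearMap.trace ℝ (EuclideanSpace ℝ (Fin d))
        ((fderivWithin ℝ v I p).comp (ContinuousLinearMap.inr ℝ ℝ (EuclideanSpace ℝ (Fin d))) :
          EuclideanSpace ℝ (Fin d) →L[ℝ] EuclideanSpace ℝ (Fin d))) I := by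
      let T : (EuclideanSpace ℝ (Fin d) →L[ℝ] EuclideanSpace ℝ (Fin d)) →ₗ[ℝ] ℝ :=
        (LinearMap.trace ℝ (EuclideanSpace ℝ (Fin d))).comp (ContinuousLinearMap.coeLM ℝ)
      exact T.continuous_of_finiteDimensional.comp_continuousOn (slicec v hv)
    refine (density_pos_along_trajectory hg' hg_nonneg hc (fun s hs x =>
      continuity_eq_nondivergence hs (hg' _ ⟨hs, trivial⟩) (slice v hv s hs x)
        (hcontinuity s hs x)) (fun s hs => hXflow s hs x) ?_ hs).ne' (hsupp s hs _ hK')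
    rw [hX0]
    exact (hg_nonneg 0 h0 x).lt_of_ne' hx
  refine htransport.integral_comp_flow volume ⟨hX0, fun x hx s hs => hKS (hpos x hx s hs),
    fun x hx s hs => ?_⟩ ht hφ
  have : w (s, X s x) = v (s, X s x) := by simp [hw, hf _ (hpos x hx s hs)]
  rw [this]
  exact hXflow s hs x
end
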